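/- arXiv:math/9806026 — 2 statements merged into one kernel-verified Lean document; each statement's English description precedes it below -/
import Mathlib

section
/- Let A and B be complex normed spaces. For continuous linear functionals f : A →L[ℂ] ℂ and g : B →L[ℂ] ℂ, let f ⊗ g : A ⊗[ℂ] B → ℂ denote the unique linear map satisfying (f ⊗ g)(a ⊗ b) = f(a) · g(b). If x ∈ A ⊗[ℂ] B satisfies (f ⊗ g)(x) = 0 for all continuous linear functionals f on A and g on B, then x = 0. (Elementary tensor functionals separate the points of the tensor product.) -/
open scoped TensorProduct

/-- For continuous linear functionals `f` on `A` and `g` on `B`, the tensor functional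
`f ⊗ g : A ⊗[ℂ] B → ℂ`, the unique linear map with `(f ⊗ g) (a ⊗ₜ b) = f a * g b`. -/
noncomputable def tensorFunctional {A B : Type*}
    [NormedAddCommGroup A] [NormedSpace ℂ A] [NormedAddCommGroup B] [NormedSpace ℂ B]
    (f : A →L[ℂ] ℂ) (g : B →L[ℂ] ℂ) : A ⊗[ℂ] B →ₗ[ℂ] ℂ :=
  TensorProduct.lift
    { toFun := fun a => f a • g.toLinearMap
      map_add' := by
        intro a b; ext c
        simp only [map_add, LinearMap.smul_apply, LinearMap.add_apply, add_smul]
      map_smul' := by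
        intro r a; ext c
        simp only [map_smul, RingHom.id_apply, LinearMap.smul_apply, smul_assoc] }

/-- The defining property of the tensor functional. -/
theorem tensorFunctional_tmul {A B : Type*}
    [NormedAddCommGroup A] [NormedSpace ℂ A] [NormedAddCommGroup B] [NormedSpace ℂ B]
    (f : A →L[ℂ] ℂ) (g : B →L[ℂ] ℂ) (a : A) (b : B) :
    tensorFunctional f g (a ⊗ₜ[ℂ] b) = f a * g b := rfl

/-- Elementary tensor functionals separate the points of the tensor product: if
`x ∈ A ⊗[ℂ] B` satisfies `(f ⊗ g) x = 0` for all continuous linear functionals `f` on `A`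
and `g` on `B`, then `x = 0`. -/
theorem tensorFunctional_separates_points {A B : Type*}
    [NormedAddCommGroup A] [NormedSpace ℂ A] [NormedAddCommGroup B] [NormedSpace ℂ B]
    (x : A ⊗[ℂ] B)
    (h : ∀ (f : A →L[ℂ] ℂ) (g : B →L[ℂ] ℂ), tensorFunctional f g x = 0) :
    x = 0 := by
  let e := Module.Basis.ofVectorSpace ℂ B
  obtain ⟨c, rfl⟩ := TensorProduct.eq_repr_basis_right e x
  have hc : c = 0 := by
    ext i
    refine SeparatingDual.eq_zero_of_forall_dual_eq_zero (R := ℂ) fun f => ?_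
    have hsum : (c.sum fun j a => f a • e j) = 0 := by
      refine SeparatingDual.eq_zero_of_forall_dual_eq_zero (R := ℂ) fun g => ?_
      simpa [Finsupp.sum, tensorFunctional_tmul] using h f g
    have hcomb : Finsupp.linearCombination ℂ e (c.mapRange f (map_zero f)) = 0 := by
      rwa [Finsupp.linearCombination_apply, Finsupp.sum_mapRange_index (by simp)]
    simpa using DFunLike.congr_fun
      (linearIndependent_iff.mp e.linearIndependent _ hcomb) i
  simp [hc]
end

section
/- Let A and B be C*-algebras and φ : A → B a (not necessarily unital) star algebra homomorphism. Then the image under φ of the closed unit ball of A is exactly (Set.range φ) ∩ (closed unit ball of B); that is, every element of the range of φ of norm at most 1 is the image of an element of A of norm at most 1. -/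
/-- A continuous function vanishing on `[-1, 1]`, such that multiplication by `(1 - k t) ^ 2`
truncates `t` to `[-1, 1]`. -/
theorem Real.exists_continuous_eqOn_zero_and_abs_mul_sq_le_one :
    ∃ k : ℝ → ℝ, Continuous k ∧ (∀ t, |t| ≤ 1 → k t = 0) ∧ ∀ t, |t * (1 - k t) ^ 2| ≤ 1 := by
  have hpos (t : ℝ) : 0 < max |t| 1 := lt_max_of_lt_right one_pos
  refine ⟨fun t ↦ 1 - (√(max |t| 1))⁻¹, ?_, fun t ht ↦ by simp [max_eq_right ht], fun t ↦ ?_⟩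
  · exact continuous_const.sub (Continuous.inv₀ (by fun_prop) fun t ↦ (Real.sqrt_pos.2 (hpos t)).ne')
  · rw [sub_sub_cancel, inv_pow, Real.sq_sqrt (hpos t).le, abs_mul, abs_inv, abs_of_pos (hpos t),
      ← div_eq_mul_inv]
    exact (div_le_one (hpos t)).2 (le_max_left _ _)

/-- The element `(1 - c) h (1 - c)` with `c = k(h)`, expanded so as to make sense in a non-unital
algebra, is given by the functional calculus. -/
theorem IsSelfAdjoint.cfcₙ_mul_one_sub_sq {A : Type*} [NonUnitalCStarAlgebra A] {h : A}
    (hsa : IsSelfAdjoint h) {k : ℝ → ℝ} (hkc : Continuous k) (hk0 : k 0 = 0) :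
    cfcₙ (fun t ↦ t * (1 - k t) ^ 2) h =
      h - h * cfcₙ k h - cfcₙ k h * h + cfcₙ k h * h * cfcₙ k h := by
  have e : (fun t ↦ t * (1 - k t) ^ 2) = fun t ↦ t - t * k t - k t * t + k t * t * k t := by
    funext t
    ring
  have hid : Continuous fun t : ℝ ↦ t := continuous_id
  have hr := hid.mul hkc
  have hl := hkc.mul hid
  have hlr := hl.mul hkc
  rw [e, cfcₙ_add (fun t ↦ t - t * k t - k t * t) (fun t ↦ k t * t * k t) h
      ((hid.sub hr).sub hl).continuousOn (by simp) hlr.continuousOn (by simp),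
    cfcₙ_sub (fun t ↦ t - t * k t) (fun t ↦ k t * t) h
      (hid.sub hr).continuousOn (by simp) hl.continuousOn (by simp),
    cfcₙ_sub (fun t ↦ t) (fun t ↦ t * k t) h hid.continuousOn rfl hr.continuousOn (by simp),
    cfcₙ_mul (fun t ↦ k t * t) k h hl.continuousOn (by simp) hkc.continuousOn hk0,
    cfcₙ_mul k (fun t ↦ t) h hkc.continuousOn hk0 hid.continuousOn rfl,
    cfcₙ_mul (fun t ↦ t) k h hid.continuousOn rfl hkc.continuousOn hk0, cfcₙ_id' ℝ h hsa]

open scoped CStarAlgebra in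
/-- If `φ x` is a contraction, then `x` can be replaced by a contraction with the same image. -/
theorem NonUnitalStarAlgHom.exists_norm_le_one_map_eq
    {A B : Type*} [NonUnitalCStarAlgebra A] [NonUnitalCStarAlgebra B]
    (φ : A →⋆ₙₐ[ℂ] B) (x : A) (hx : ‖φ x‖ ≤ 1) : ∃ y : A, ‖y‖ ≤ 1 ∧ φ y = φ x := by
  obtain ⟨k, hkc, hk, hk1⟩ := Real.exists_continuous_eqOn_zero_and_abs_mul_sq_le_one
  have hk0 : k 0 = 0 := hk 0 (by simp)
  have hsa : IsSelfAdjoint (star x * x) := .star_mul_self x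
  have hcsa : star (cfcₙ k (star x * x)) = cfcₙ k (star x * x) :=
    (cfcₙ_predicate k (star x * x) : IsSelfAdjoint _).star_eq
  refine ⟨x - x * cfcₙ k (star x * x), ?_, ?_⟩
  · have hnorm := norm_cfcₙ_le (a := star x * x) (fun t _ ↦ hk1 t)
    have key : star (x - x * cfcₙ k (star x * x)) * (x - x * cfcₙ k (star x * x)) =
        cfcₙ (fun t ↦ t * (1 - k t) ^ 2) (star x * x) := by
      rw [hsa.cfcₙ_mul_one_sub_sq hkc hk0, star_sub, star_mul, hcsa]
      generalize cfcₙ k (star x * x) = c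
      noncomm_ring
    rw [← key, CStarRing.norm_star_mul_self] at hnorm
    nlinarith [norm_nonneg (x - x * cfcₙ k (star x * x))]
  · have hφsa : IsSelfAdjoint (φ (star x * x)) := hsa.map φ
    have hφh : ‖φ (star x * x)‖ ≤ 1 := by
      rw [map_mul, map_star, CStarRing.norm_star_mul_self]
      exact mul_le_one₀ hx (norm_nonneg _) hx
    have hφc : φ (cfcₙ k (star x * x)) = 0 := by
      rw [NonUnitalStarAlgHom.map_cfcₙ (S := ℂ) φ k (star x * x) hkc.continuousOn hk0
        (map_continuous φ) hsa hφsa, ← cfcₙ_const_zero ℝ (φ (star x * x))]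
      refine cfcₙ_congr fun t ht ↦ hk t ?_
      have := norm_apply_le_norm_cfcₙ (fun t : ℝ ↦ t) (φ (star x * x)) ht continuousOn_id rfl hφsa
      rw [cfcₙ_id' ℝ _ hφsa] at this
      exact this.trans hφh
    rw [map_sub, map_mul, hφc, mul_zero, sub_zero]


/-- A star algebra homomorphism between C*-algebras maps the closed unit ball of `A`
exactly onto the intersection of its range with the closed unit ball of `B`. -/
theorem starAlgHom_image_closedBall
    {A B : Type*}
    [NonUnitalNormedRing A] [StarRing A] [CStarRing A] [NormedSpace ℂ A]
    [IsScalarTower ℂ A A] [SMulCommClass ℂ A A] [StarModule ℂ A] [CompleteSpace A]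
    [NonUnitalNormedRing B] [StarRing B] [CStarRing B] [NormedSpace ℂ B]
    [IsScalarTower ℂ B B] [SMulCommClass ℂ B B] [StarModule ℂ B] [CompleteSpace B]
    (φ : A →⋆ₙₐ[ℂ] B) :
    φ '' Metric.closedBall 0 1 = Set.range φ ∩ Metric.closedBall 0 1 := by
  let : NonUnitalCStarAlgebra A := {}
  let : NonUnitalCStarAlgebra B := {}
  ext b
  simp only [Set.mem_image, Set.mem_inter_iff, Set.mem_range, mem_closedBall_zero_iff]
  constructor
  · rintro ⟨a, ha, rfl⟩
    exact ⟨⟨a, rfl⟩, (NonUnitalStarAlgHom.norm_apply_le φ a).trans ha⟩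
  · rintro ⟨⟨x, rfl⟩, hx⟩
    exact NonUnitalStarAlgHom.exists_norm_le_one_map_eq φ x hx
end
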